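/- arXiv:1802.10409 — 3 statements merged into one kernel-verified Lean document; each statement's English description precedes it below -/
import Mathlib

section
/- Let S be the field of Puiseux series over an algebraically closed field of characteristic zero. Then S is algebraically closed. -/
open Polynomial

namespace HahnSeries

variable {Γ Γ' R : Type*} [LinearOrder Γ] [LinearOrder Γ'] [Zero R]

theorem mem_range_embDomain_iff (f : Γ ↪o Γ') (x : HahnSeries Γ' R) :
    x ∈ Set.range (embDomain f : HahnSeries Γ R → HahnSeries Γ' R) ↔
      x.support ⊆ Set.range f := by
  constructor
  · rintro ⟨y, rfl⟩
    exact support_embDomain_subset.trans (Set.image_subset_range _ _)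
  · intro hx
    have hwf : (Function.support fun a => x.coeff (f a)).IsPWO := by
      rw [Set.isPWO_iff_isWF]
      have hx' := x.isWF_support
      rw [Set.isWF_iff_no_descending_seq] at hx' ⊢
      exact fun u hu hmem => hx' (f ∘ u) (f.strictMono.comp_strictAnti hu) hmem
    refine ⟨⟨fun a => x.coeff (f a), hwf⟩, ?_⟩
    ext b
    by_cases hb : b ∈ Set.range f
    · obtain ⟨a, rfl⟩ := hb
      rw [embDomain_coeff]
    · rw [embDomain_of_notMem_range hb]
      by_contra h
      exact hb (hx (Ne.symm h))

end HahnSeries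

namespace Polynomial

/-- A polynomial over a complete local ring whose reduction vanishes at `0` but has a
nonzero coefficient below the degree has a proper monic factor. -/
theorem exists_monic_dvd_of_coeff_zero_mem_maximalIdeal {A : Type*} [CommRing A] [IsLocalRing A]
    [IsAdicComplete (IsLocalRing.maximalIdeal A) A] {f : A[X]}
    (h0 : f.coeff 0 ∈ IsLocalRing.maximalIdeal A)
    (h : ∃ i < f.natDegree, f.coeff i ∉ IsLocalRing.maximalIdeal A) :
    ∃ g : A[X], g.Monic ∧ g ∣ f ∧ 0 < g.natDegree ∧ g.natDegree < f.natDegree := by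
  obtain ⟨i, hi, hfi⟩ := h
  have hcoeff : PowerSeries.coeff i ((f : PowerSeries A).map (IsLocalRing.residue A)) ≠ 0 := by
    simpa using hfi
  have hne : (f : PowerSeries A).map (IsLocalRing.residue A) ≠ 0 := by
    intro h
    simp [h] at hcoeff
  obtain ⟨g, u, hgu⟩ := PowerSeries.exists_isWeierstrassFactorization hne
  have hu : PowerSeries.constantCoeff u ∉ IsLocalRing.maximalIdeal A := by
    simpa using PowerSeries.isUnit_iff_constantCoeff.mp hgu.isUnit
  have hdeg : (g.natDegree : ℕ∞) = ((f : PowerSeries A).map (IsLocalRing.residue A)).order :=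
    hgu.isDistinguishedAt.coe_natDegree_eq_order_map _ u hu hgu.eq_mul
  refine ⟨g, hgu.isDistinguishedAt.monic, ?_, ?_, ?_⟩
  · rw [← Ideal.mem_span_singleton, ← Ideal.Quotient.eq_zero_iff_mem]
    apply hgu.isDistinguishedAt.algEquivQuotient.injective
    rw [map_zero]
    change Ideal.Quotient.mk _ (f : PowerSeries A) = 0
    rw [Ideal.Quotient.eq_zero_iff_mem, Ideal.mem_span_singleton]
    exact ⟨u, hgu.eq_mul⟩
  · rw [Nat.pos_iff_ne_zero]
    intro hg
    rw [hg, eq_comm, Nat.cast_zero] at hdeg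
    refine PowerSeries.order_ne_zero_iff_constCoeff_eq_zero.mpr ?_ hdeg
    rw [← PowerSeries.coeff_zero_eq_constantCoeff_apply]
    simpa using h0
  · have := PowerSeries.order_le i hcoeff
    rw [← hdeg] at this
    exact lt_of_le_of_lt (by exact_mod_cast this) hi

/-- A monic polynomial over `K⟦t⟧` with vanishing subleading coefficient whose reduction
is not a power of `X` has a proper monic factor. -/
theorem Monic.exists_monic_dvd_of_powerSeries {K : Type*} [Field K] [IsAlgClosed K] [CharZero K]
    {f : (PowerSeries K)[X]} (hf : f.Monic) (hsub : f.coeff (f.natDegree - 1) = 0)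
    (h : ∃ i < f.natDegree, PowerSeries.constantCoeff (f.coeff i) ≠ 0) :
    ∃ g : (PowerSeries K)[X], g.Monic ∧ g ∣ f ∧ 0 < g.natDegree ∧
      g.natDegree < f.natDegree := by
  have hmem (x : PowerSeries K) :
      x ∈ IsLocalRing.maximalIdeal (PowerSeries K) ↔ PowerSeries.constantCoeff x = 0 := by
    rw [PowerSeries.maximalIdeal_eq_span_X, Ideal.mem_span_singleton, PowerSeries.X_dvd_iff]
  have : IsAdicComplete (IsLocalRing.maximalIdeal (PowerSeries K)) (PowerSeries K) := by
    rw [PowerSeries.maximalIdeal_eq_span_X]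
    infer_instance
  obtain ⟨i, hi, hfi⟩ := h
  set F : K[X] := f.map PowerSeries.constantCoeff with hF
  have hFm : F.Monic := hf.map _
  have hFdeg : F.natDegree = f.natDegree := hf.natDegree_map _
  obtain ⟨a, ha⟩ := IsAlgClosed.exists_root F (by
    rw [Polynomial.degree_eq_natDegree hFm.ne_zero, hFdeg]
    exact_mod_cast (Nat.zero_lt_of_lt hi).ne')
  have hmap : (taylor (PowerSeries.C a) f).map PowerSeries.constantCoeff = taylor a F := by
    simp [hF]
  obtain ⟨g, hgm, ⟨q, hq⟩, hg0, hgd⟩ :=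
    exists_monic_dvd_of_coeff_zero_mem_maximalIdeal (f := taylor (PowerSeries.C a) f) (by
      rw [hmem, ← coeff_map, hmap, taylor_coeff_zero]
      exact ha) (by
      by_contra! hall
      have hX : taylor a F = X ^ F.natDegree := by
        ext j
        rw [coeff_X_pow]
        rcases lt_trichotomy j F.natDegree with hj | hj | hj
        · rw [if_neg hj.ne, ← hmap, coeff_map, ← hmem]
          exact hall j (by rwa [natDegree_taylor, ← hFdeg])
        · rw [if_pos hj, hj, coeff_taylor_natDegree, hFm]
        · rw [if_neg hj.ne', coeff_eq_zero_of_natDegree_lt (by rwa [natDegree_taylor])]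
      have hF' : F = (X + C (-a)) ^ F.natDegree := by
        rw [← taylor_X_pow, ← hX, taylor_taylor]
        simp
      have hsubF : F.coeff (F.natDegree - 1) = 0 := by
        rw [hFdeg, hF, coeff_map, hsub, map_zero]
      have ha0 : a = 0 := by
        rw [hF', coeff_X_add_C_pow, ← hF'] at hsubF
        have h1 : F.natDegree - (F.natDegree - 1) = 1 := by omega
        have h2 : F.natDegree.choose (F.natDegree - 1) = F.natDegree := by
          rw [Nat.choose_symm (by omega), Nat.choose_one_right]
        rw [h1, h2] at hsubF
        have h3 : (F.natDegree : K) ≠ 0 := by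
          exact_mod_cast (by omega : F.natDegree ≠ 0)
        simpa [h3] using hsubF
      apply hfi
      rw [← coeff_map, ← hF, hF', ha0]
      simp [coeff_X_pow, hFdeg, hi.ne])
  refine ⟨taylor (-PowerSeries.C a) g, ?_, ⟨taylor (-PowerSeries.C a) q, ?_⟩, ?_, ?_⟩
  · rw [Monic, leadingCoeff_taylor, hgm]
  · rw [← taylor_mul, ← hq, taylor_taylor]
    simp
  · rwa [natDegree_taylor]
  · rwa [natDegree_taylor, ← natDegree_taylor f (PowerSeries.C a)]

/-- The Tschirnhaus transformation kills the subleading coefficient. -/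
theorem Monic.exists_taylor_coeff_natDegree_sub_one_eq_zero {F : Type*} [Field F] [CharZero F]
    {p : F[X]} (hp : p.Monic) (hdeg : 0 < p.natDegree) :
    ∃ c : F, (taylor c p).coeff (p.natDegree - 1) = 0 := by
  obtain ⟨n, hn⟩ : ∃ n, p.natDegree = n + 1 := ⟨p.natDegree - 1, by omega⟩
  refine ⟨-(p.coeff n / (n + 1)), ?_⟩
  have hlin : hasseDeriv n p = C ((n + 1 : F)) * X + C (p.coeff n) := by
    ext j
    rw [hasseDeriv_coeff]
    rcases j with _ | _ | j
    · simp
    · have : p.coeff (n + 1) = 1 := by rw [← hn]; exact hp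
      simp [this, add_comm 1 n]
    · rw [coeff_eq_zero_of_natDegree_lt (by omega)]
      simp [Polynomial.coeff_one]
  rw [hn, Nat.add_sub_cancel, taylor_coeff, hlin]
  have : (n + 1 : F) ≠ 0 := by exact_mod_cast n.succ_ne_zero
  simp
  field_simp
  ring

end Polynomial

namespace Puiseux

open HahnSeries

variable (K : Type*) [Field K]

/-- The ring homomorphism `∑ aₘ Tᵐ ↦ ∑ aₘ T ^ f m` of Hahn series. -/
noncomputable def reindex {Γ : Type*} [AddCommMonoid Γ] [LinearOrder Γ]
    [IsOrderedCancelAddMonoid Γ] (f : Γ →+ ℚ) (hf : StrictMono f) :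
    HahnSeries Γ K →+* HahnSeries ℚ K :=
  embDomainRingHom f hf.injective fun _ _ => hf.le_iff_le

variable {K}

theorem mem_range_reindex_iff {Γ : Type*} [AddCommMonoid Γ] [LinearOrder Γ]
    [IsOrderedCancelAddMonoid Γ] (f : Γ →+ ℚ) (hf : StrictMono f) (x : HahnSeries ℚ K) :
    x ∈ Set.range (reindex K f hf) ↔ x.support ⊆ Set.range f :=
  mem_range_embDomain_iff ⟨⟨f, hf.injective⟩, hf.le_iff_le⟩ x

theorem coeff_reindex {Γ : Type*} [AddCommMonoid Γ] [LinearOrder Γ]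
    [IsOrderedCancelAddMonoid Γ] (f : Γ →+ ℚ) (hf : StrictMono f) (x : HahnSeries Γ K) (a : Γ) :
    (reindex K f hf x).coeff (f a) = x.coeff a :=
  embDomain_coeff (f := ⟨⟨f, hf.injective⟩, hf.le_iff_le⟩)

/-- The map `m ↦ m / n` from `ℤ` to `ℚ`. -/
def intDiv (n : ℕ) : ℤ →+ ℚ := (AddMonoidHom.mulRight (n : ℚ)⁻¹).comp (Int.castAddHom ℚ)

theorem intDiv_apply (n : ℕ) (m : ℤ) : intDiv n m = m / n := rfl

theorem strictMono_intDiv {n : ℕ} (hn : 0 < n) : StrictMono (intDiv n) := fun a b hab => by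
  rw [intDiv_apply, intDiv_apply]
  gcongr

/-- The map `m ↦ m / n` from `ℕ` to `ℚ`. -/
def natDiv (n : ℕ) : ℕ →+ ℚ := (AddMonoidHom.mulRight (n : ℚ)⁻¹).comp (Nat.castAddMonoidHom ℚ)

theorem natDiv_apply (n m : ℕ) : natDiv n m = m / n := rfl

theorem strictMono_natDiv {n : ℕ} (hn : 0 < n) : StrictMono (natDiv n) := fun a b hab => by
  rw [natDiv_apply, natDiv_apply]
  gcongr

theorem range_intDiv_subset {n k : ℕ} (hk : 0 < k) (h : n ∣ k) :
    Set.range (intDiv n) ⊆ Set.range (intDiv k) := by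
  obtain ⟨d, rfl⟩ := h
  rintro _ ⟨m, rfl⟩
  refine ⟨m * d, ?_⟩
  have hn : (n : ℚ) ≠ 0 := by rintro h; simp_all
  have hd : (d : ℚ) ≠ 0 := by rintro h; simp_all
  rw [intDiv_apply, intDiv_apply]
  push_cast
  field_simp

theorem mem_fieldRange_reindex_mul {n k : ℕ} (hn : 0 < n) (hk : 0 < k) {x y : HahnSeries ℚ K}
    (hx : x.support ⊆ Set.range (intDiv n)) (hy : y.support ⊆ Set.range (intDiv k)) :
    x ∈ (reindex K _ (strictMono_intDiv (Nat.mul_pos hn hk))).fieldRange ∧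
      y ∈ (reindex K _ (strictMono_intDiv (Nat.mul_pos hn hk))).fieldRange :=
  ⟨(mem_range_reindex_iff _ _ x).mpr
      (hx.trans (range_intDiv_subset (Nat.mul_pos hn hk) (dvd_mul_right n k))),
    (mem_range_reindex_iff _ _ y).mpr
      (hy.trans (range_intDiv_subset (Nat.mul_pos hn hk) (dvd_mul_left k n)))⟩

theorem support_subset_of_mem_fieldRange {n : ℕ} (hn : 0 < n) {x : HahnSeries ℚ K}
    (hx : x ∈ (reindex K _ (strictMono_intDiv hn)).fieldRange) :
    ∃ n : ℕ, 0 < n ∧ x.support ⊆ Set.range (intDiv n) :=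
  ⟨n, hn, (mem_range_reindex_iff _ _ x).mp hx⟩

variable (K) in
/-- The field of Puiseux series: Hahn series with rational exponents of bounded denominator. -/
noncomputable def puiseuxSubfield : Subfield (HahnSeries ℚ K) where
  carrier := {x | ∃ n : ℕ, 0 < n ∧ x.support ⊆ Set.range (intDiv n)}
  mul_mem' := by
    rintro x y ⟨n, hn, hx⟩ ⟨k, hk, hy⟩
    have h := mem_fieldRange_reindex_mul hn hk hx hy
    exact support_subset_of_mem_fieldRange (Nat.mul_pos hn hk) (mul_mem h.1 h.2)
  add_mem' := by
    rintro x y ⟨n, hn, hx⟩ ⟨k, hk, hy⟩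
    have h := mem_fieldRange_reindex_mul hn hk hx hy
    exact support_subset_of_mem_fieldRange (Nat.mul_pos hn hk) (add_mem h.1 h.2)
  one_mem' := support_subset_of_mem_fieldRange one_pos (one_mem _)
  zero_mem' := support_subset_of_mem_fieldRange one_pos (zero_mem _)
  neg_mem' := by
    rintro x ⟨n, hn, hx⟩
    exact support_subset_of_mem_fieldRange hn (neg_mem ((mem_range_reindex_iff _ _ x).mpr hx))
  inv_mem' := by
    rintro x ⟨n, hn, hx⟩
    exact support_subset_of_mem_fieldRange hn (inv_mem ((mem_range_reindex_iff _ _ x).mpr hx))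

theorem mem_puiseuxSubfield {x : HahnSeries ℚ K} :
    x ∈ puiseuxSubfield K ↔ ∃ n : ℕ, 0 < n ∧ x.support ⊆ Set.range (intDiv n) := Iff.rfl

theorem single_mem_puiseuxSubfield (q : ℚ) (a : K) : single q a ∈ puiseuxSubfield K := by
  refine ⟨q.den, q.den_pos, support_single_subset.trans ?_⟩
  rw [Set.singleton_subset_iff]
  exact ⟨q.num, Rat.num_div_den q⟩

/-- The embedding `K⟦t⟧ → K⟨⟨T⟩⟩` with `t ↦ T ^ (1 / n)`. -/
noncomputable def ofPowerSeries {n : ℕ} (hn : 0 < n) : PowerSeries K →+* puiseuxSubfield K :=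
  ((reindex K _ (strictMono_natDiv hn)).comp
    (HahnSeries.toPowerSeries (R := K)).symm.toRingHom).codRestrict (puiseuxSubfield K) fun x =>
      ⟨n, hn, ((mem_range_reindex_iff _ (strictMono_natDiv hn) _).mp ⟨_, rfl⟩).trans (by
        rintro _ ⟨m, rfl⟩
        exact ⟨m, by simp [intDiv_apply, natDiv_apply]⟩)⟩

theorem coeff_zero_ofPowerSeries {n : ℕ} (hn : 0 < n) (x : PowerSeries K) :
    (ofPowerSeries hn x : HahnSeries ℚ K).coeff 0 = PowerSeries.constantCoeff x := by
  have h := coeff_reindex (natDiv n) (strictMono_natDiv hn) (toPowerSeries.symm x) 0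
  rw [map_zero, coeff_toPowerSeries_symm, PowerSeries.coeff_zero_eq_constantCoeff] at h
  exact h

theorem ofPowerSeries_injective {n : ℕ} (hn : 0 < n) :
    Function.Injective (ofPowerSeries (K := K) hn) := by
  intro x y hxy
  have h : reindex K _ (strictMono_natDiv hn) (toPowerSeries.symm x) =
      reindex K _ (strictMono_natDiv hn) (toPowerSeries.symm y) := congrArg Subtype.val hxy
  exact toPowerSeries.symm.injective (embDomain_injective h)

theorem mem_range_ofPowerSeries {n : ℕ} (hn : 0 < n) (x : puiseuxSubfield K)
    (hx : (x : HahnSeries ℚ K).support ⊆ Set.range (intDiv n))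
    (h0 : ∀ q < 0, (x : HahnSeries ℚ K).coeff q = 0) :
    x ∈ Set.range (ofPowerSeries (K := K) hn) := by
  have hsupp : (x : HahnSeries ℚ K).support ⊆ Set.range (natDiv n) := by
    intro q hq
    obtain ⟨m, rfl⟩ := hx hq
    have hm : 0 ≤ m := by
      by_contra! hm
      refine hq (h0 _ ?_)
      simpa using strictMono_intDiv hn hm
    lift m to ℕ using hm
    exact ⟨m, by simp [intDiv_apply, natDiv_apply]⟩
  obtain ⟨y, hy⟩ := (mem_range_reindex_iff _ (strictMono_natDiv hn) _).mpr hsupp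
  refine ⟨toPowerSeries y, Subtype.ext ?_⟩
  rw [← hy]
  exact congrArg (reindex K _ (strictMono_natDiv hn)) (toPowerSeries.symm_apply_apply y)

theorem exists_common_denominator {ι : Type*} (s : Finset ι) (x : ι → puiseuxSubfield K) :
    ∃ n : ℕ, 0 < n ∧ ∀ i ∈ s, (x i : HahnSeries ℚ K).support ⊆ Set.range (intDiv n) := by
  choose d hd hx using fun i => mem_puiseuxSubfield.mp (x i).2
  have hpos : 0 < ∏ i ∈ s, d i := Finset.prod_pos fun i _ => hd i
  exact ⟨_, hpos, fun i hi => (hx i).trans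
    (range_intDiv_subset hpos (Finset.dvd_prod_of_mem d hi))⟩

/-- A monic polynomial other than a power of `X` can be rescaled so that its coefficients are
integral and some non-leading coefficient is a unit. -/
theorem exists_scaleRoots (p : (puiseuxSubfield K)[X]) (hp : p.Monic)
    (h : ∃ i < p.natDegree, p.coeff i ≠ 0) :
    ∃ s : puiseuxSubfield K, s ≠ 0 ∧
      (∀ j, ∀ q < 0, ((p.scaleRoots s).coeff j : HahnSeries ℚ K).coeff q = 0) ∧
      ∃ i < p.natDegree, ((p.scaleRoots s).coeff i : HahnSeries ℚ K).coeff 0 ≠ 0 := by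
  classical
  obtain ⟨i₀, hi₀, hpi₀⟩ := h
  set I := (Finset.range p.natDegree).filter fun i => p.coeff i ≠ 0 with hI
  obtain ⟨i, hiI, hmin⟩ := I.exists_min_image
    (fun i => (p.coeff i : HahnSeries ℚ K).order / ((p.natDegree - i : ℕ) : ℚ))
    ⟨i₀, by simp [hI, hi₀, hpi₀]⟩
  set γ := (p.coeff i : HahnSeries ℚ K).order / ((p.natDegree - i : ℕ) : ℚ) with hγ
  rw [hI, Finset.mem_filter, Finset.mem_range] at hiI
  have hcoeff (j : ℕ) (q : ℚ) :
      ((p.scaleRoots ⟨single (-γ) 1, single_mem_puiseuxSubfield _ _⟩).coeff j :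
        HahnSeries ℚ K).coeff q =
      (p.coeff j : HahnSeries ℚ K).coeff (q + (p.natDegree - j : ℕ) * γ) := by
    rw [coeff_scaleRoots]
    simp only [MulMemClass.coe_mul, SubmonoidClass.coe_pow, single_pow, one_pow]
    conv_lhs => rw [show q = (q + (p.natDegree - j : ℕ) * γ) + (p.natDegree - j) • (-γ) by
      simp]
    rw [coeff_mul_single_add, mul_one]
  refine ⟨⟨single (-γ) 1, single_mem_puiseuxSubfield _ _⟩, ?_, ?_, i, hiI.1, ?_⟩
  · intro h0
    exact single_ne_zero (one_ne_zero (α := K)) (congrArg Subtype.val h0)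
  · intro j q hq
    rw [hcoeff]
    rcases lt_trichotomy j p.natDegree with hj | rfl | hj
    · by_cases hpj : p.coeff j = 0
      · simp [hpj]
      · apply coeff_eq_zero_of_lt_order
        have hpos : (0 : ℚ) < (p.natDegree - j : ℕ) := by
          exact_mod_cast Nat.sub_pos_of_lt hj
        have := hmin j (by simp [hI, hj, hpj])
        rw [le_div_iff₀ hpos] at this
        linarith
    · rw [coeff_natDegree, hp]
      simp [HahnSeries.coeff_one, hq.ne]
    · simp [coeff_eq_zero_of_natDegree_lt hj]
  · have hpos : ((p.natDegree - i : ℕ) : ℚ) ≠ 0 := by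
      exact_mod_cast (Nat.sub_pos_of_lt hiI.1).ne'
    rw [hcoeff, hγ, zero_add, mul_div_cancel₀ _ hpos]
    simpa [coeff_order_eq_zero] using hiI.2

theorem exists_eval_eq_zero [IsAlgClosed K] [CharZero K] (n : ℕ) :
    ∀ p : (puiseuxSubfield K)[X], p.Monic → p.natDegree = n → 0 < n → ∃ x, p.eval x = 0 := by
  have : CharZero (puiseuxSubfield K) :=
    charZero_of_injective_ringHom ((HahnSeries.C (Γ := ℚ) (R := K)).codRestrict
      (puiseuxSubfield K) (single_mem_puiseuxSubfield 0)).injective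
  induction n using Nat.strong_induction_on with
  | _ n ih =>
  intro p hp hpn hn
  obtain ⟨c, hc⟩ := hp.exists_taylor_coeff_natDegree_sub_one_eq_zero (hpn ▸ hn)
  suffices ∃ x, (taylor c p).eval x = 0 by
    obtain ⟨x, hx⟩ := this
    exact ⟨x + c, by rwa [← taylor_eval]⟩
  have hrm : (taylor c p).Monic := by rw [Monic, leadingCoeff_taylor, hp]
  have hrn : (taylor c p).natDegree = n := by rw [natDegree_taylor, hpn]
  rw [hpn] at hc
  generalize taylor c p = r at hc hrm hrn
  by_cases hr : ∃ i < r.natDegree, r.coeff i ≠ 0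
  · obtain ⟨s, hs, hint, hunit⟩ := exists_scaleRoots r hrm hr
    suffices ∃ x, (r.scaleRoots s).eval x = 0 by
      obtain ⟨x, hx⟩ := this
      refine ⟨s⁻¹ * x, ?_⟩
      have := scaleRoots_eval_mul r (s⁻¹ * x) s
      rw [mul_inv_cancel_left₀ hs, hx] at this
      exact (mul_eq_zero.mp this.symm).resolve_left (pow_ne_zero _ hs)
    have htm := (monic_scaleRoots_iff s).mpr hrm
    have htn : (r.scaleRoots s).natDegree = n := by rw [natDegree_scaleRoots, hrn]
    have htc : (r.scaleRoots s).coeff (n - 1) = 0 := by rw [coeff_scaleRoots, hc, zero_mul]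
    rw [hrn] at hunit
    generalize r.scaleRoots s = t at hint hunit htm htn htc
    obtain ⟨N, hN, hden⟩ := exists_common_denominator t.support t.coeff
    have hlift : t ∈ lifts (ofPowerSeries (K := K) hN) := by
      rw [lifts_iff_coeff_lifts]
      intro j
      by_cases hj : j ∈ t.support
      · exact mem_range_ofPowerSeries hN _ (hden j hj) (hint j)
      · rw [notMem_support_iff.mp hj]
        exact ⟨0, map_zero _⟩
    obtain ⟨f, hft, hfn, hfm⟩ := lifts_and_natDegree_eq_and_monic hlift htm
    have hcoeff (j : ℕ) : t.coeff j = ofPowerSeries hN (f.coeff j) := by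
      rw [← hft, coeff_map]
    rw [htn] at hfn
    obtain ⟨g, hgm, ⟨q, hq⟩, hg0, hgn⟩ := hfm.exists_monic_dvd_of_powerSeries
      (by
        rw [hfn]
        apply ofPowerSeries_injective hN
        rw [← hcoeff, htc, map_zero])
      (by
        obtain ⟨i, hi, hti⟩ := hunit
        rw [hcoeff, coeff_zero_ofPowerSeries] at hti
        exact ⟨i, hfn ▸ hi, hti⟩)
    obtain ⟨x, hx⟩ := ih g.natDegree (hfn ▸ hgn) (g.map (ofPowerSeries hN)) (hgm.map _)
      (hgm.natDegree_map _) hg0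
    refine ⟨x, ?_⟩
    rw [← hft, hq, Polynomial.map_mul, eval_mul, hx, zero_mul]
  · push Not at hr
    refine ⟨0, ?_⟩
    rw [← coeff_zero_eq_eval_zero]
    exact hr 0 (hrn ▸ hn)

end Puiseux

/-- The field of Puiseux series over an algebraically closed field `K` of
characteristic zero — realized as the subfield of the Hahn series field
`HahnSeries ℚ K` consisting of series whose support has bounded denominators —
is algebraically closed. -/
theorem stmt9 (K : Type*) [Field K] [IsAlgClosed K] [CharZero K] :
    ∃ S : Subfield (HahnSeries ℚ K),
      (∀ f : HahnSeries ℚ K, f ∈ S ↔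
        ∃ n : ℕ, 0 < n ∧ ∀ q ∈ f.support, ∃ m : ℤ, q = (m : ℚ) / n) ∧
      IsAlgClosed S := by
  refine ⟨Puiseux.puiseuxSubfield K, fun f => ?_, ?_⟩
  · rw [Puiseux.mem_puiseuxSubfield]
    simp only [Set.subset_def, Set.mem_range, Puiseux.intDiv_apply, eq_comm]
  · exact .of_exists_root _ fun p hp hirr =>
      Puiseux.exists_eval_eq_zero _ p hp rfl hirr.natDegree_pos
end

section
/- Let K be algebraically closed of characteristic zero, and let J ⊂ K[T,X_1,...,X_n] be an ideal satisfying: (B1) every irreducible component of V(J) has dimension at least one, and (B2) every localization of J at a maximal ideal of height n is unmixed. Let x be an isolated solution of the fiber system B_τ = B(τ,X) for some τ ∈ K, where B generates J. Then (τ,x) lies in some one-dimensional irreducible component of V(J) whose projection to the T-line is dominant, and (τ,x) does not lie in V(P) for any other associated prime P of J. -/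
open MvPolynomial

/-- The height of the prime `P`, expressed as the Krull dimension of the poset of
primes contained in `P`. -/
noncomputable def primeHt (R : Type*) [CommRing R] (P : Ideal R) : WithBot ℕ∞ :=
  Order.krullDim {Q : PrimeSpectrum R // Q.asIdeal ≤ P}

/-- `P ⊆ K[T,X₁,…,Xₙ]` contains no nonzero polynomial of `K[T]`; geometrically,
`V(P)` projects dominantly to the `T`-line.  Here `K[T,X₁,…,Xₙ]` is modelled as
`MvPolynomial (Option (Fin n)) K`, the variable `none` playing the role of `T`. -/
def Dominant {n : ℕ} {K : Type*} [CommRing K]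
    (P : Ideal (MvPolynomial (Option (Fin n)) K)) : Prop :=
  ∀ f : Polynomial K,
    Polynomial.aeval (MvPolynomial.X (none : Option (Fin n))) f ∈ P → f = 0

theorem primeHt_eq_height {R : Type*} [CommRing R] (P : Ideal R) [hP : P.IsPrime] :
    primeHt R P = P.height := by
  have h := Order.height_eq_krullDim_Iic (⟨P, hP⟩ : PrimeSpectrum R)
  rw [← PrimeSpectrum.height_eq_orderHeight] at h
  exact h.symm

/-- Every maximal ideal of a polynomial ring over a field has height the number of variables. -/
theorem MvPolynomial.height_of_isMaximal {k σ : Type*} [Field k] [Finite σ]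
    (M : Ideal (MvPolynomial σ k)) [hM : M.IsMaximal] : M.height = Nat.card σ := by
  induction σ using Finite.induction_empty_option with
  | of_equiv e ih =>
    have := Ideal.comap_isMaximal_of_equiv (renameEquiv k e) (p := M)
    rw [← Nat.card_congr e, ← ih (M.comap (renameEquiv k e))]
    exact ((renameEquiv k e).toRingEquiv.height_comap M).symm
  | h_empty =>
    have h0 := Ideal.height_le_ringKrullDim_of_ne_top hM.ne_top
    rw [ringKrullDim_of_isNoetherianRing] at h0
    simpa using h0
  | @h_option τ _ ih =>
    let e := (optionEquivLeft k τ).symm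
    have := Ideal.comap_isMaximal_of_equiv e (p := M)
    have hmax := Polynomial.isMaximal_comap_C_of_isJacobsonRing (M.comap e)
    have : (M.comap e).LiesOver ((M.comap e).comap Polynomial.C) := ⟨rfl⟩
    have h := Polynomial.height_eq_height_add_one ((M.comap e).comap Polynomial.C) (M.comap e)
    rw [ih] at h
    rw [← e.toRingEquiv.height_comap M]
    exact h.trans (by simp)

/-- In an affine domain, every maximal ideal has height the dimension of the ring. -/
theorem Ideal.height_eq_ringKrullDim_of_finiteType (k : Type*) {A : Type*} [Field k] [CommRing A]
    [IsDomain A] [Algebra k A] [Algebra.FiniteType k A] (m : Ideal A) [hm : m.IsMaximal] :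
    (m.height : WithBot ℕ∞) = ringKrullDim A := by
  obtain ⟨s, g, hinj, hint⟩ := exists_integral_inj_algHom_of_fg k A
  let := g.toRingHom.toAlgebra
  have : Algebra.IsIntegral (MvPolynomial (Fin s) k) A := ⟨hint⟩
  have : FaithfulSMul (MvPolynomial (Fin s) k) A :=
    (faithfulSMul_iff_algebraMap_injective _ _).mpr hinj
  have : IsNoetherianRing A := Algebra.FiniteType.isNoetherianRing k A
  have key (q : Ideal A) [q.IsMaximal] : q.height = s := by
    let p := q.under (MvPolynomial (Fin s) k)
    have hp : p.IsMaximal := Ideal.isMaximal_comap_of_isIntegral_of_isMaximal q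
    have : q.LiesOver p := ⟨rfl⟩
    have hpq : p.map (algebraMap _ A) ≤ q := Ideal.map_comap_le
    have hzero : (q.map (Ideal.Quotient.mk (p.map (algebraMap _ A)))).height = 0 := by
      have : (q.map (Ideal.Quotient.mk (p.map (algebraMap _ A)))).IsPrime :=
        Ideal.isPrime_map_quotientMk_of_isPrime hpq
      rw [Ideal.height_eq_zero_iff]
      have : Ring.KrullDimLE 0 (A ⧸ p.map (algebraMap _ A)) := Ring.KrullDimLE.mk₀ fun I hI ↦ by
        have hI' : (I.comap (Ideal.Quotient.mk (p.map (algebraMap _ A)))).IsMaximal := by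
          have hle : p ≤ (I.comap (Ideal.Quotient.mk (p.map (algebraMap _ A)))).under _ := by
            rw [Ideal.under_def, ← Ideal.map_le_iff_le_comap]
            exact Ideal.mk_ker.symm.trans_le (Ideal.comap_mono bot_le)
          apply Ideal.isMaximal_of_isIntegral_of_isMaximal_comap (R := MvPolynomial (Fin s) k)
          rwa [← Ideal.under_def, ← hp.eq_of_le (Ideal.IsPrime.ne_top inferInstance) hle]
        rw [← Ideal.map_comap_of_surjective _ Ideal.Quotient.mk_surjective I]
        exact hI'.map_of_surjective_of_ker_le Ideal.Quotient.mk_surjective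
          (Ideal.comap_mono bot_le)
      exact Ideal.mem_minimalPrimes_of_krullDimLE_zero _
    rw [Ideal.height_eq_height_add_of_liesOver_of_hasGoingDown p q, hzero,
      MvPolynomial.height_of_isMaximal p]
    simp
  refine le_antisymm (Ideal.height_le_ringKrullDim_of_ne_top hm.ne_top) ?_
  rw [ringKrullDim_le_iff_isMaximal_height_le]
  intro q hq
  rw [key q, key m]

attribute [local instance] MvPolynomial.algebraMvPolynomial in
/-- A prime of `A[X₁,…,Xₙ]` which is maximal among the primes lying over `0` has height `n`. -/
theorem MvPolynomial.height_of_maximal_over_bot {A σ : Type*} [CommRing A] [IsDomain A] [Finite σ]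
    (P : Ideal (MvPolynomial σ A)) [hP : P.IsPrime] (hbot : ∀ f : A, C f ∈ P → f = 0)
    (hmax : ∀ Q : Ideal (MvPolynomial σ A), Q.IsPrime → P ≤ Q →
      (∀ f : A, C f ∈ Q → f = 0) → Q ≤ P) :
    P.height = Nat.card σ := by
  let F := FractionRing A
  let N := (nonZeroDivisors A).map (C (σ := σ))
  have hdisj : Disjoint (N : Set (MvPolynomial σ A)) P := by
    rw [Set.disjoint_left]
    rintro _ ⟨f, hf, rfl⟩ hfP
    exact nonZeroDivisors.ne_zero hf (hbot f hfP)
  have hPF : (P.map (algebraMap _ (MvPolynomial σ F))).IsPrime :=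
    IsLocalization.isPrime_of_isPrime_disjoint N _ P hP hdisj
  have : (P.map (algebraMap _ (MvPolynomial σ F))).IsMaximal := by
    obtain ⟨Q, hQ, hle⟩ := Ideal.exists_le_maximal _ hPF.ne_top
    have hQP : Q.comap (algebraMap _ (MvPolynomial σ F)) ≤ P := by
      refine hmax _ inferInstance (Ideal.map_le_iff_le_comap.mp hle) fun f hf ↦ ?_
      by_contra hf0
      refine hQ.ne_top (Ideal.eq_top_of_isUnit_mem _ hf ?_)
      exact IsLocalization.map_units (MvPolynomial σ F)
        (⟨C f, f, mem_nonZeroDivisors_of_ne_zero hf0, rfl⟩ : N)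
    have : Q ≤ P.map (algebraMap _ (MvPolynomial σ F)) := by
      rw [← IsLocalization.map_under N (MvPolynomial σ F) Q]
      exact Ideal.map_mono hQP
    rwa [le_antisymm hle this]
  rw [← IsLocalization.height_map_of_disjoint (S := MvPolynomial σ F) N P hdisj]
  exact MvPolynomial.height_of_isMaximal _

section IsolatedPoint

variable {K : Type*} [Field K] [IsAlgClosed K] {n : ℕ}

/-- A prime contained in the ideal of `(τ, x)` which is not dominant contains `T - τ`. -/
theorem X_none_sub_C_mem_of_not_dominant {P : Ideal (MvPolynomial (Option (Fin n)) K)}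
    [P.IsPrime] {τ : K} {x : Fin n → K}
    (hPM : P ≤ RingHom.ker (eval (fun o : Option (Fin n) => o.elim τ x))) (hP : ¬ Dominant P) :
    X none - C τ ∈ P := by
  simp only [Dominant, not_forall] at hP
  obtain ⟨f, hf, hf0⟩ := hP
  have hsplit := (IsAlgClosed.splits f).eq_prod_roots
  rw [hsplit, map_mul, map_multiset_prod, Multiset.map_map] at hf
  rcases Ideal.IsPrime.mem_or_mem inferInstance hf with h | h
  · refine absurd (P.eq_top_of_isUnit_mem h ?_) (Ideal.IsPrime.ne_top inferInstance)
    rw [Polynomial.aeval_C]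
    exact (isUnit_iff_ne_zero.mpr (Polynomial.leadingCoeff_ne_zero.mpr hf0)).map _
  · obtain ⟨p, hp, hc⟩ :=
      (Ideal.IsPrime.multiset_prod_mem_iff_exists_mem (I := P) inferInstance _).mp h
    obtain ⟨c, -, rfl⟩ := Multiset.mem_map.mp hp
    have hc' : X none - C c ∈ P := by simpa [MvPolynomial.algebraMap_eq] using hc
    have : τ - c = 0 := by simpa [RingHom.mem_ker] using hPM hc'
    rwa [sub_eq_zero.mp this]

/-- A dominant prime of coheight at most one has height `n`. -/
theorem Dominant.height_eq {P : Ideal (MvPolynomial (Option (Fin n)) K)} [hP : P.IsPrime]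
    (hdom : Dominant P) (hdim : ringKrullDim (MvPolynomial (Option (Fin n)) K ⧸ P) ≤ 1) :
    P.height = n := by
  let e := (optionEquivRight K (Fin n)).symm
  have he (f : Polynomial K) : e (C f) = Polynomial.aeval (X none) f := by
    simp [e]
  have hmax (Q : Ideal (MvPolynomial (Option (Fin n)) K)) (hQ : Q.IsPrime) (hPQ : P ≤ Q)
      (hQdom : Dominant Q) : Q ≤ P := by
    by_contra hne
    have : Q.IsMaximal := by
      have : Ring.KrullDimLE 1 (MvPolynomial (Option (Fin n)) K ⧸ P) :=
        Ring.krullDimLE_iff.mpr (by simpa using hdim)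
      have hker : RingHom.ker (Ideal.Quotient.mk P) ≤ Q := Ideal.mk_ker.trans_le hPQ
      have := Ideal.isPrime_map_quotientMk_of_isPrime hPQ
      have hbar : (Q.map (Ideal.Quotient.mk P)).IsMaximal :=
        Ideal.isMaximal_of_isPrime_of_ne_bot _ fun h0 ↦
          hne (Ideal.mk_ker (I := P) ▸ (Ideal.map_eq_bot_iff_le_ker _).mp h0)
      have hcomap := Ideal.comap_map_of_surjective' (Ideal.Quotient.mk P)
        Ideal.Quotient.mk_surjective Q
      rw [sup_eq_left.mpr hker] at hcomap
      rw [← hcomap]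
      exact Ideal.comap_isMaximal_of_surjective _ Ideal.Quotient.mk_surjective
    obtain ⟨z, rfl⟩ := isMaximal_iff_eq_vanishingIdeal_singleton.mp this
    refine Polynomial.X_sub_C_ne_zero (z none) (hQdom _ ?_)
    simp
  rw [← e.toRingEquiv.height_comap P]
  refine (MvPolynomial.height_of_maximal_over_bot (P.comap e) (fun f hf ↦ hdom f ?_)
    fun Q hQ hPQ hQdom ↦ ?_).trans (by simp)
  · rwa [Ideal.mem_comap, he] at hf
  · have := hmax (Q.comap e.symm) inferInstance (fun p hp ↦ hPQ (by simpa using hp))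
      (fun f hf ↦ hQdom f (by rwa [Ideal.mem_comap, ← he, e.symm_apply_apply] at hf))
    intro q hq
    exact this (by simpa using hq)

variable {ι : Type*} {b : ι → MvPolynomial (Option (Fin n)) K} {τ : K} {x : Fin n → K}

/-- If `x` is an isolated point of the fibre over `τ` of the zero locus of `b`, then the ideal of
`(τ, x)` is the only prime below it containing `b` and `T - τ`. -/
theorem eq_ker_eval_of_isolated {h : MvPolynomial (Fin n) K} (hx : eval x h ≠ 0)
    (hiso : ∀ y : Fin n → K, (∀ i, eval (fun o => o.elim τ y) (b i) = 0) → eval y h ≠ 0 → y = x)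
    {Q : Ideal (MvPolynomial (Option (Fin n)) K)} [hQ : Q.IsPrime]
    (hbQ : Ideal.span (Set.range b) ≤ Q) (hτ : X none - C τ ∈ Q)
    (hQM : Q ≤ RingHom.ker (eval (fun o : Option (Fin n) => o.elim τ x))) :
    Q = RingHom.ker (eval (fun o : Option (Fin n) => o.elim τ x)) := by
  refine le_antisymm hQM fun f hf ↦ ?_
  have hmul : f * rename some h ∈ Q := by
    rw [← IsPrime.vanishingIdeal_zeroLocus (K := K) Q, mem_vanishingIdeal_iff]
    intro z hz
    have hz' : z = fun o => o.elim τ (z ∘ some) := by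
      funext o
      cases o with
      | none => simpa [sub_eq_zero] using hz _ hτ
      | some i => rfl
    rw [map_mul, aeval_rename, mul_eq_zero, or_iff_not_imp_right]
    intro hne
    have := hiso (z ∘ some) (fun i ↦ ?_) hne
    · rw [hz', this]
      exact hf
    · rw [← hz']
      exact hz _ (hbQ (Ideal.subset_span ⟨i, rfl⟩))
  refine (hQ.mem_or_mem hmul).resolve_right fun hh ↦ hx ?_
  have := hQM hh
  rw [RingHom.mem_ker, eval_rename] at this
  exact this

/-- A prime of positive coheight containing `b` and passing through a point `(τ, x)`, with `x`
isolated in the fibre over `τ`, defines a curve dominating the `T`-line. -/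
theorem ringKrullDim_eq_one_and_dominant_of_isolated {h : MvPolynomial (Fin n) K}
    (hx : eval x h ≠ 0)
    (hiso : ∀ y : Fin n → K, (∀ i, eval (fun o => o.elim τ y) (b i) = 0) → eval y h ≠ 0 → y = x)
    {P : Ideal (MvPolynomial (Option (Fin n)) K)} [hP : P.IsPrime]
    (hbP : Ideal.span (Set.range b) ≤ P)
    (hPM : P ≤ RingHom.ker (eval (fun o : Option (Fin n) => o.elim τ x)))
    (hdim : 1 ≤ ringKrullDim (MvPolynomial (Option (Fin n)) K ⧸ P)) :
    ringKrullDim (MvPolynomial (Option (Fin n)) K ⧸ P) = 1 ∧ Dominant P := by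
  have hM : (RingHom.ker (eval (fun o : Option (Fin n) => o.elim τ x))).IsMaximal :=
    RingHom.ker_isMaximal_of_surjective _ fun c ↦ ⟨C c, by simp⟩
  set M := RingHom.ker (eval (fun o : Option (Fin n) => o.elim τ x)) with hMdef
  constructor
  · have hmin : M ∈ (P ⊔ Ideal.span {X none - C τ}).minimalPrimes := by
      refine ⟨⟨hM.isPrime, sup_le hPM ?_⟩, fun Q ⟨hQ, hle⟩ hQM ↦ ?_⟩
      · rw [Ideal.span_singleton_le_iff_mem]
        simp [hMdef, RingHom.mem_ker]
      · exact (eq_ker_eval_of_isolated hx hiso (hbP.trans (le_sup_left.trans hle))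
          (hle (Ideal.mem_sup_right (Ideal.mem_span_singleton_self _))) hQM).ge
    have hbar : (M.map (Ideal.Quotient.mk P)).IsMaximal :=
      hM.map_of_surjective_of_ker_le Ideal.Quotient.mk_surjective (Ideal.mk_ker.trans_le hPM)
    refine le_antisymm ?_ hdim
    rw [← Ideal.height_eq_ringKrullDim_of_finiteType K (M.map (Ideal.Quotient.mk P))]
    exact_mod_cast Ideal.map_height_le_one_of_mem_minimalPrimes hmin
  · by_contra hdom
    have hPeq := eq_ker_eval_of_isolated hx hiso hbP (X_none_sub_C_mem_of_not_dominant hPM hdom) hPM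
    rw [ringKrullDim_eq_zero_of_isField] at hdim
    · exact absurd hdim (not_le.mpr zero_lt_one)
    · rw [← Ideal.Quotient.maximal_ideal_iff_isField_quotient, hPeq]
      exact hM

end IsolatedPoint

/-- Let `J ⊆ K[T,X₁,…,Xₙ]` (generated by `B`) satisfy: (B1) every irreducible
component of `V(J)` has dimension at least one, and (B2) every localization of
`J` at a maximal ideal of height `n` is unmixed.  If `x` is an isolated solution
of the fiber system `B_τ`, then `(τ,x)` lies in a one-dimensional irreducible
component of `V(J)` dominating the `T`-line, and every associated prime of `J`
whose variety contains `(τ,x)` is a minimal prime defining such a component. -/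
theorem stmt12 (K : Type*) [Field K] [IsAlgClosed K] [CharZero K] (n m : ℕ)
    (b : Fin m → MvPolynomial (Option (Fin n)) K)
    (J : Ideal (MvPolynomial (Option (Fin n)) K)) (hJ : J = Ideal.span (Set.range b))
    (hB1 : ∀ P : Ideal (MvPolynomial (Option (Fin n)) K), P.IsPrime →
      P ∈ J.minimalPrimes →
      (1 : WithBot ℕ∞) ≤ ringKrullDim (MvPolynomial (Option (Fin n)) K ⧸ P))
    (hB2 : ∀ M : Ideal (MvPolynomial (Option (Fin n)) K), M.IsMaximal → J ≤ M →
      ((∀ P ∈ J.minimalPrimes, P ≤ M → (n : WithBot ℕ∞) ≤ primeHt _ P) ∧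
        (∃ P ∈ J.minimalPrimes, P ≤ M ∧ primeHt _ P = (n : WithBot ℕ∞))) →
      ∀ P ∈ associatedPrimes (MvPolynomial (Option (Fin n)) K)
          ((MvPolynomial (Option (Fin n)) K) ⧸ J),
        P ≤ M → primeHt _ P = (n : WithBot ℕ∞))
    (τ : K) (x : Fin n → K)
    (hroot : ∀ i, MvPolynomial.eval (fun o => o.elim τ x) (b i) = 0)
    (hiso : ∃ h : MvPolynomial (Fin n) K, MvPolynomial.eval x h ≠ 0 ∧
      ∀ y : Fin n → K, (∀ i, MvPolynomial.eval (fun o => o.elim τ y) (b i) = 0) →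
        MvPolynomial.eval y h ≠ 0 → y = x) :
    (∃ P ∈ J.minimalPrimes,
        ringKrullDim (MvPolynomial (Option (Fin n)) K ⧸ P) = (1 : WithBot ℕ∞) ∧
        Dominant P ∧
        P ≤ RingHom.ker (MvPolynomial.eval (fun o => o.elim τ x))) ∧
    (∀ P ∈ associatedPrimes (MvPolynomial (Option (Fin n)) K)
        ((MvPolynomial (Option (Fin n)) K) ⧸ J),
      P ≤ RingHom.ker (MvPolynomial.eval (fun o => o.elim τ x)) →
        P ∈ J.minimalPrimes ∧
        ringKrullDim (MvPolynomial (Option (Fin n)) K ⧸ P) = (1 : WithBot ℕ∞) ∧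
        Dominant P) := by
  obtain ⟨h, hx, hiso⟩ := hiso
  have hM : (RingHom.ker (eval (fun o : Option (Fin n) => o.elim τ x))).IsMaximal :=
    RingHom.ker_isMaximal_of_surjective _ fun c ↦ ⟨C c, by simp⟩
  have hJM : J ≤ RingHom.ker (eval (fun o : Option (Fin n) => o.elim τ x)) := by
    rw [hJ, Ideal.span_le]
    rintro _ ⟨i, rfl⟩
    exact hroot i
  have hcurve (P) (hP : P ∈ J.minimalPrimes)
      (hPM : P ≤ RingHom.ker (eval (fun o : Option (Fin n) => o.elim τ x))) :
      ringKrullDim (MvPolynomial (Option (Fin n)) K ⧸ P) = 1 ∧ Dominant P :=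
    have := hP.isPrime
    ringKrullDim_eq_one_and_dominant_of_isolated hx hiso (hJ ▸ hP.le) hPM (hB1 P hP.isPrime hP)
  have hheight (P) (hP : P ∈ J.minimalPrimes)
      (hPM : P ≤ RingHom.ker (eval (fun o : Option (Fin n) => o.elim τ x))) : P.height = n :=
    have := hP.isPrime
    (hcurve P hP hPM).2.height_eq (hcurve P hP hPM).1.le
  have hprimeHt (P) (hP : P ∈ J.minimalPrimes)
      (hPM : P ≤ RingHom.ker (eval (fun o : Option (Fin n) => o.elim τ x))) :
      primeHt _ P = (n : WithBot ℕ∞) := by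
    have := hP.isPrime
    rw [primeHt_eq_height, hheight P hP hPM]
    rfl
  obtain ⟨P₀, hP₀, hP₀M⟩ := Ideal.exists_minimalPrimes_le hJM
  refine ⟨⟨P₀, hP₀, (hcurve P₀ hP₀ hP₀M).1, (hcurve P₀ hP₀ hP₀M).2, hP₀M⟩, fun P hP hPM ↦ ?_⟩
  have hPprime : P.IsPrime := hP.1
  have hPht := hB2 _ hM hJM ⟨fun Q hQ hQM ↦ (hprimeHt Q hQ hQM).ge,
    P₀, hP₀, hP₀M, hprimeHt P₀ hP₀ hP₀M⟩ P hP hPM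
  have hJP : J ≤ P := by
    have := IsAssociatedPrime.annihilator_le hP
    rwa [Submodule.annihilator_top, Ideal.annihilator_quotient] at this
  obtain ⟨Q, hQ, hQP⟩ := Ideal.exists_minimalPrimes_le hJP
  have hQprime := hQ.isPrime
  obtain rfl | hlt := hQP.eq_or_lt
  · exact ⟨hQ, hcurve Q hQ hPM⟩
  · have hstrict := Ideal.height_strict_mono_of_isPrime hlt
    rw [← WithBot.coe_lt_coe, ← primeHt_eq_height, ← primeHt_eq_height, hPht,
      hprimeHt Q hQ (hQP.trans hPM)] at hstrict
    exact absurd hstrict (lt_irrefl _)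
end

section
/- With notation as in the symbolic homotopy setting (B satisfying B1, B2, and x an isolated solution of B_τ), the multiplicity of the ideal J + ⟨T − τ⟩ at (τ,x) equals the multiplicity of J' + ⟨T − τ⟩ at (τ,x), where J' = Q_1 ∩ ··· ∩ Q_t is the intersection of the primary components of J associated to one-dimensional components dominating the T-line. -/
open MvPolynomial

/-- Multiplicity of `pt` with respect to `I`: dimension of the formal power
series quotient after translating `pt` to the origin. -/
noncomputable def multAt {σ K : Type*} [Field K]
    (I : Ideal (MvPolynomial σ K)) (pt : σ → K) : ℕ :=
  Module.finrank K (MvPowerSeries σ K ⧸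
    Ideal.map ((MvPolynomial.coeToMvPowerSeries.ringHom).comp
      ((MvPolynomial.aeval
        (fun v => MvPolynomial.X v + MvPolynomial.C (pt v)) :
          MvPolynomial σ K →ₐ[K] MvPolynomial σ K)).toRingHom) I)

section CommutativeAlgebra

variable {K : Type*} [Field K]

/-- The inequality `N ≤ ht P + trdeg (R ⧸ P)` for every prime `P` of a `K`-algebra `R`. -/
def HeightTrdegBound (K R : Type*) [Field K] [CommRing R] [Algebra K R] (N : ℕ) : Prop :=
  ∀ P : Ideal R, P.IsPrime → (N : ℕ∞) ≤ P.height + (Algebra.trdeg K (R ⧸ P)).toENat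

theorem HeightTrdegBound.of_algEquiv {R S : Type*} [CommRing R] [CommRing S] [Algebra K R]
    [Algebra K S] {N : ℕ} (e : R ≃ₐ[K] S) (h : HeightTrdegBound K R N) :
    HeightTrdegBound K S N := by
  intro P hP
  have hcomap : (P.comap (e : R →+* S)).IsPrime := hP.comap _
  have hheight : (P.comap (e : R →+* S)).height = P.height := e.toRingEquiv.height_comap P
  have hmap : P = (P.comap (e : R →+* S)).map (e : R →+* S) :=
    (Ideal.map_comap_of_surjective _ e.surjective P).symm
  have htrdeg := (Ideal.quotientEquivAlg _ P e hmap).lift_trdeg_eq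
  have := h _ hcomap
  rwa [hheight, ← Cardinal.toENat_lift, htrdeg, Cardinal.toENat_lift] at this

theorem HeightTrdegBound.polynomial {A : Type*} [CommRing A] [IsNoetherianRing A] [Algebra K A]
    {N : ℕ} (h : HeightTrdegBound K A N) : HeightTrdegBound K (Polynomial A) (N + 1) := by
  intro P hP
  set p : Ideal A := P.comap Polynomial.C
  have hpP : p.IsPrime := hP.comap _
  have hover : P.LiesOver p := ⟨rfl⟩
  have hle : p.map Polynomial.C ≤ P := Ideal.map_comap_le
  have hheight := Ideal.height_eq_height_add_of_liesOver_of_hasGoingDown p P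
  have hbound := h p hpP
  rw [hheight]
  push_cast
  by_cases heq : p.map Polynomial.C = P
  · let e := Ideal.polynomialQuotientEquivQuotientPolynomial p
    let f : Polynomial (A ⧸ p) →ₐ[K] (Polynomial A ⧸ p.map Polynomial.C) :=
      { (e : Polynomial (A ⧸ p) →+* _) with
        commutes' := fun r ↦ by
          change e (Polynomial.C (Ideal.Quotient.mk p (algebraMap K A r))) = _
          rw [← Polynomial.map_C, Ideal.polynomialQuotientEquivQuotientPolynomial_map_mk]
          rfl }
    have hadd := trdeg_add_eq K (A ⧸ p) (A := Polynomial (A ⧸ p))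
    rw [Polynomial.trdeg_of_isDomain] at hadd
    have hle' := trdeg_le_of_injective f e.injective
    rw [← hadd, heq] at hle'
    have := Cardinal.toENat.monotone' hle'
    have h' : (Algebra.trdeg K (A ⧸ p)).toENat + 1 ≤
        (Algebra.trdeg K (Polynomial A ⧸ P)).toENat := by simpa using this
    calc (N : ℕ∞) + 1 ≤ p.height + ((Algebra.trdeg K (A ⧸ p)).toENat + 1) := by
          rw [← add_assoc]; gcongr
      _ ≤ _ := by gcongr; exact le_self_add
  · have hprime : (p.map (algebraMap A (Polynomial A))).IsPrime :=
      Ideal.isPrime_map_C_of_isPrime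
    have hone : 1 ≤ (P.map (Ideal.Quotient.mk (p.map (algebraMap A (Polynomial A))))).height := by
      rw [Order.one_le_iff_ne_zero, Ne, Ideal.height_eq_zero_iff_eq_bot, Ideal.map_eq_bot_iff_le_ker,
        Ideal.mk_ker]
      exact fun hPle ↦ heq (hle.antisymm hPle)
    have hle' := trdeg_le_of_injective
      (Ideal.quotientMapₐ P (Algebra.ofId A (Polynomial A) |>.restrictScalars K) le_rfl :
        A ⧸ p →ₐ[K] Polynomial A ⧸ P) (Ideal.quotientMap_injective' (H := le_rfl) le_rfl)
    calc (N : ℕ∞) + 1 ≤ p.height + (Algebra.trdeg K (A ⧸ p)).toENat + 1 := by gcongr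
      _ = p.height + 1 + (Algebra.trdeg K (A ⧸ p)).toENat := add_right_comm _ _ _
      _ ≤ _ := by gcongr

theorem heightTrdegBound_mvPolynomial (ι : Type) [Finite ι] :
    HeightTrdegBound K (MvPolynomial ι K) (Nat.card ι) := by
  induction ι using Finite.induction_empty_option with
  | of_equiv e h => exact Nat.card_congr e ▸ h.of_algEquiv (renameEquiv K e)
  | h_empty => intro P _; simp
  | h_option h =>
    rw [Finite.card_option]
    exact h.polynomial.of_algEquiv (optionEquivLeft K _).symm

end CommutativeAlgebra

theorem ringKrullDim_le_of_isIntegral (A B : Type*) [CommRing A] [CommRing B] [Algebra A B]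
    [Algebra.IsIntegral A B] : ringKrullDim B ≤ ringKrullDim A :=
  Order.krullDim_le_of_strictMono (PrimeSpectrum.comap (algebraMap A B))
    fun _ _ h ↦ Ideal.IsIntegral.comap_lt_comap h

theorem card_le_height_of_isMaximal {K : Type*} [Field K] {ι : Type} [Finite ι]
    (M : Ideal (MvPolynomial ι K)) [hM : M.IsMaximal] : (Nat.card ι : ℕ∞) ≤ M.height := by
  have hbound := heightTrdegBound_mvPolynomial (K := K) ι M hM.isPrime
  let _ : Field (MvPolynomial ι K ⧸ M) := Ideal.Quotient.field M
  have : Module.Finite K (MvPolynomial ι K ⧸ M) := finite_of_finite_type_of_isJacobsonRing _ _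
  simpa [trdeg_eq_zero] using hbound

/-- Noether normalization compares dimension, transcendence degree and heights of maximal ideals. -/
theorem exists_nat_trdeg_eq_and_le_height {K B : Type*} [Field K] [CommRing B] [IsDomain B]
    [Algebra K B] [Algebra.FiniteType K B] (M : Ideal B) [M.IsMaximal] :
    ∃ s : ℕ, ringKrullDim B ≤ s ∧ (Algebra.trdeg K B).toENat = s ∧ (s : ℕ∞) ≤ M.height := by
  obtain ⟨s, g, hinj, hint⟩ := exists_integral_inj_algHom_of_fg K B
  algebraize [g.toRingHom]
  have : FaithfulSMul (MvPolynomial (Fin s) K) B :=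
    (faithfulSMul_iff_algebraMap_injective _ _).2 hinj
  have : IsNoetherianRing B := Algebra.FiniteType.isNoetherianRing K B
  refine ⟨s, ?_, ?_, ?_⟩
  · simpa using ringKrullDim_le_of_isIntegral (MvPolynomial (Fin s) K) B
  · have h := lift_trdeg_add_eq K (MvPolynomial (Fin s) K) B
    rw [trdeg_eq_zero (R := MvPolynomial (Fin s) K) (A := B), trdeg_of_isDomain] at h
    rw [← Cardinal.toENat_lift, ← h]
    simp
  · have hmax := Ideal.isMaximal_comap_of_isIntegral_of_isMaximal (R := MvPolynomial (Fin s) K) M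
    have hover : M.LiesOver (M.comap (algebraMap (MvPolynomial (Fin s) K) B)) := ⟨rfl⟩
    rw [Ideal.height_eq_height_add_of_liesOver_of_hasGoingDown
      (M.comap (algebraMap (MvPolynomial (Fin s) K) B)) M]
    refine le_add_right ?_
    simpa using card_le_height_of_isMaximal (M.comap (algebraMap (MvPolynomial (Fin s) K) B))

theorem radical_mem_associatedPrimes {R : Type*} [CommRing R] [IsNoetherianRing R] {r : ℕ}
    {J : Ideal R} (Q : Fin r → Ideal R) (hprimary : ∀ i, (Q i).IsPrimary) (hdec : J = ⨅ i, Q i)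
    (hdist : ∀ i j, i ≠ j → (Q i).radical ≠ (Q j).radical)
    (hirred : ∀ i : Fin r, ¬ (⨅ j ∈ Finset.univ.erase i, Q j) ≤ Q i) (i : Fin r) :
    (Q i).radical ∈ associatedPrimes R (R ⧸ J) := by
  classical
  have ht : Submodule.IsMinimalPrimaryDecomposition J (Finset.univ.image Q) := by
    refine ⟨?_, ?_, ?_, ?_⟩
    · rw [hdec, Finset.inf_image, Finset.inf_univ_eq_iInf]
      rfl
    · simpa using hprimary
    · intro I hI I' hI' hne
      simp only [Finset.coe_image, Finset.coe_univ, Set.image_univ, Set.mem_range] at hI hI'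
      obtain ⟨a, rfl⟩ := hI
      obtain ⟨a', rfl⟩ := hI'
      simpa [Function.onFun] using hdist a a' fun h ↦ hne (congrArg Q h)
    · intro I hI hle
      simp only [Finset.mem_image, Finset.mem_univ, true_and] at hI
      obtain ⟨a, rfl⟩ := hI
      refine hirred a (le_trans (Finset.le_inf fun I hI ↦ ?_) hle)
      simp only [Finset.mem_erase, Finset.mem_image, Finset.mem_univ, true_and] at hI
      obtain ⟨hne, a', rfl⟩ := hI
      exact iInf₂_le a' (by simpa using fun h : a' = a ↦ hne (congrArg Q h))
  have hmem := ht.mem_associatedPrimes (q := Q i) (by simp)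
  obtain ⟨hprime, x, hx⟩ := Submodule.isAssociatedPrime_iff.1 hmem
  simp only [Submodule.colon_univ] at hprime hx
  refine isAssociatedPrime_iff.2 ⟨hprime, Ideal.Quotient.mk J x, ?_⟩
  rw [hx]
  ext y
  rw [Submodule.mem_colon_singleton, Submodule.mem_colon_singleton, Submodule.mem_bot,
    Algebra.smul_def (A := R ⧸ J), Ideal.Quotient.algebraMap_eq, ← map_mul,
    Ideal.Quotient.eq_zero_iff_mem, smul_eq_mul]

theorem Ideal.map_eq_map_of_mul_mem {R S : Type*} [CommRing R] [CommRing S] (f : R →+* S)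
    {I I' : Ideal R} (hle : I ≤ I') {g : R} (hg : IsUnit (f g)) (hmul : ∀ a ∈ I', g * a ∈ I) :
    I.map f = I'.map f := by
  refine (Ideal.map_mono hle).antisymm (Ideal.map_le_iff_le_comap.2 fun a ha ↦ ?_)
  have h := Ideal.mem_map_of_mem f (hmul a ha)
  rw [map_mul] at h
  exact (Ideal.unit_mul_mem_iff_mem _ hg).1 h

theorem isUnit_translate_of_eval_ne_zero {σ K : Type*} [Field K] (pt : σ → K)
    {g : MvPolynomial σ K} (hg : eval pt g ≠ 0) :
    IsUnit (((MvPolynomial.coeToMvPowerSeries.ringHom).comp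
      ((MvPolynomial.aeval
        (fun v => MvPolynomial.X v + MvPolynomial.C (pt v)) :
          MvPolynomial σ K →ₐ[K] MvPolynomial σ K)).toRingHom) g) := by
  rw [MvPowerSeries.isUnit_iff_constantCoeff, isUnit_iff_ne_zero]
  convert hg using 1
  have : (MvPowerSeries.constantCoeff (R := K) (σ := σ)).comp
      ((MvPolynomial.coeToMvPowerSeries.ringHom).comp
      ((MvPolynomial.aeval
        (fun v => MvPolynomial.X v + MvPolynomial.C (pt v)) :
          MvPolynomial σ K →ₐ[K] MvPolynomial σ K)).toRingHom) = eval pt := by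
    ext <;> simp
  exact congrArg (fun φ : MvPolynomial σ K →+* K ↦ φ g) this

/-- If every point of `V(I)` with `h ≠ 0` is `pt`, then the maximal ideal of `pt` is minimal
over `I`. -/
theorem vanishingIdeal_singleton_mem_minimalPrimes {σ K : Type*} [Finite σ] [Field K]
    [IsAlgClosed K] {I : Ideal (MvPolynomial σ K)} {pt : σ → K} {h : MvPolynomial σ K}
    (hI : I ≤ vanishingIdeal K {pt}) (hpt : eval pt h ≠ 0)
    (hiso : ∀ y ∈ zeroLocus K I, eval y h ≠ 0 → y = pt) :
    vanishingIdeal K {pt} ∈ I.minimalPrimes := by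
  refine ⟨⟨inferInstance, hI⟩, fun P ⟨hP, hIP⟩ hle g hg ↦ ?_⟩
  have hmul : h * g ∈ P := by
    rw [← IsPrime.vanishingIdeal_zeroLocus (K := K) P]
    intro y hy
    by_cases hy' : eval y h = 0
    · simp [aeval_eq_eval, hy']
    · rw [hiso y (zeroLocus_anti_mono hIP hy) hy', map_mul,
        (mem_vanishingIdeal_singleton_iff pt g).1 hg, mul_zero]
  refine (hP.mem_or_mem hmul).resolve_left fun hh ↦ hpt ?_
  exact (mem_vanishingIdeal_singleton_iff pt h).1 (hle hh)

theorem ringKrullDim_quotient_le_one_and_height_eq {K : Type*} [Field K] {n : ℕ}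
    {P M : Ideal (MvPolynomial (Option (Fin n)) K)} [P.IsPrime] [hM : M.IsMaximal]
    {t : MvPolynomial (Option (Fin n)) K} (hne : P ≠ M)
    (hmin : M ∈ (P ⊔ Ideal.span {t}).minimalPrimes) :
    ringKrullDim (MvPolynomial (Option (Fin n)) K ⧸ P) ≤ 1 ∧ P.height = n := by
  have hle : P ≤ M := le_sup_left.trans hmin.1.2
  have hmax : (M.map (Ideal.Quotient.mk P)).IsMaximal :=
    .map_of_surjective_of_ker_le Ideal.Quotient.mk_surjective (by rwa [Ideal.mk_ker])
  obtain ⟨s, hdim, htrdeg, hs⟩ :=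
    exists_nat_trdeg_eq_and_le_height (K := K) (M.map (Ideal.Quotient.mk P))
  have hs1 : s ≤ 1 := by
    exact_mod_cast hs.trans (Ideal.map_height_le_one_of_mem_minimalPrimes hmin)
  refine ⟨hdim.trans (by exact_mod_cast hs1), ?_⟩
  have hlow := heightTrdegBound_mvPolynomial (K := K) (Option (Fin n)) P inferInstance
  have hMheight : M.height ≤ (n + 1 : ℕ) := by
    have := Ideal.height_le_ringKrullDim_of_ne_top hM.ne_top
    rw [MvPolynomial.ringKrullDim_of_isNoetherianRing, ringKrullDim_eq_zero_of_field, zero_add,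
      Finite.card_option, Nat.card_fin] at this
    exact_mod_cast this
  have hupper := (Ideal.height_add_one_le_of_lt_of_isPrime (hle.lt_of_ne hne)).trans hMheight
  rw [htrdeg, Finite.card_option, Nat.card_fin] at hlow
  obtain ⟨k, hk⟩ := ENat.ne_top_iff_exists.1 (Ideal.height_ne_top_of_isPrime (I := P))
  rw [← hk] at hlow hupper ⊢
  norm_cast at *
  omega

/-- A prime which contains a nonzero polynomial in `T` and vanishes at a point with `T = τ`
contains `T - τ`. -/
theorem X_sub_C_mem_of_not_dominant {K : Type*} [Field K] [IsAlgClosed K] {n : ℕ}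
    {P : Ideal (MvPolynomial (Option (Fin n)) K)} [hP : P.IsPrime] {pt : Option (Fin n) → K}
    (hpt : P ≤ vanishingIdeal K {pt}) (hdom : ¬ Dominant P) :
    (X none - C (pt none) : MvPolynomial (Option (Fin n)) K) ∈ P := by
  simp only [Dominant, not_forall] at hdom
  obtain ⟨f, hf, hf0⟩ := hdom
  rw [(IsAlgClosed.splits f).eq_prod_roots, map_mul, map_multiset_prod, Multiset.map_map] at hf
  have hlead : Polynomial.aeval (X none : MvPolynomial (Option (Fin n)) K)
      (Polynomial.C f.leadingCoeff) ∉ P := fun h ↦ by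
    refine hP.ne_top (Ideal.eq_top_of_isUnit_mem _ h ?_)
    rw [Polynomial.aeval_C]
    exact (isUnit_iff_ne_zero.2 (Polynomial.leadingCoeff_ne_zero.2 hf0)).map _
  obtain ⟨p, hp, hpP⟩ := (hP.multiset_prod_mem_iff_exists_mem _).1
    ((hP.mem_or_mem hf).resolve_left hlead)
  obtain ⟨c, -, rfl⟩ := Multiset.mem_map.1 hp
  have hX : (X none - C c : MvPolynomial (Option (Fin n)) K) ∈ P := by
    simpa [MvPolynomial.algebraMap_eq] using hpP
  have hc := (mem_vanishingIdeal_singleton_iff pt _).1 (hpt hX)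
  simp only [map_sub, aeval_X, aeval_C, Algebra.algebraMap_self, RingHom.id_apply] at hc
  rwa [sub_eq_zero.1 hc]

/-- In the symbolic homotopy setting (`J` generated by `B` satisfying B1 and B2,
`x` an isolated solution of the fiber `B_τ`), with `J = Q₁ ∩ ⋯ ∩ Q_r` an
irredundant primary decomposition and `J' = ⋂_{i ∈ S} Q_i` the intersection of
those primary components whose associated primes define one-dimensional
components dominating the `T`-line, the multiplicity of `J + ⟨T - τ⟩` at
`(τ,x)` equals the multiplicity of `J' + ⟨T - τ⟩` at `(τ,x)`. -/
theorem stmt13 (K : Type*) [Field K] [IsAlgClosed K] [CharZero K] (n m r : ℕ)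
    (b : Fin m → MvPolynomial (Option (Fin n)) K)
    (J : Ideal (MvPolynomial (Option (Fin n)) K)) (hJ : J = Ideal.span (Set.range b))
    (hB1 : ∀ P : Ideal (MvPolynomial (Option (Fin n)) K), P.IsPrime →
      P ∈ J.minimalPrimes →
      (1 : WithBot ℕ∞) ≤ ringKrullDim (MvPolynomial (Option (Fin n)) K ⧸ P))
    (hB2 : ∀ M : Ideal (MvPolynomial (Option (Fin n)) K), M.IsMaximal → J ≤ M →
      ((∀ P ∈ J.minimalPrimes, P ≤ M → (n : WithBot ℕ∞) ≤ primeHt _ P) ∧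
        (∃ P ∈ J.minimalPrimes, P ≤ M ∧ primeHt _ P = (n : WithBot ℕ∞))) →
      ∀ P ∈ associatedPrimes (MvPolynomial (Option (Fin n)) K)
          ((MvPolynomial (Option (Fin n)) K) ⧸ J),
        P ≤ M → primeHt _ P = (n : WithBot ℕ∞))
    (Q : Fin r → Ideal (MvPolynomial (Option (Fin n)) K))
    (hQprimary : ∀ i, (Q i).IsPrimary)
    (hdec : J = ⨅ i, Q i)
    (hraddist : ∀ i j, i ≠ j → (Q i).radical ≠ (Q j).radical)
    (hirred : ∀ i : Fin r, ¬ (⨅ j ∈ Finset.univ.erase i, Q j) ≤ Q i)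
    (S : Finset (Fin r))
    (hS : ∀ i, i ∈ S ↔ ((Q i).radical ∈ J.minimalPrimes ∧
      ringKrullDim (MvPolynomial (Option (Fin n)) K ⧸ (Q i).radical) = (1 : WithBot ℕ∞) ∧
      Dominant (Q i).radical))
    (τ : K) (x : Fin n → K)
    (hroot : ∀ i, MvPolynomial.eval (fun o => o.elim τ x) (b i) = 0)
    (hiso : ∃ h : MvPolynomial (Fin n) K, MvPolynomial.eval x h ≠ 0 ∧
      ∀ y : Fin n → K, (∀ i, MvPolynomial.eval (fun o => o.elim τ y) (b i) = 0) →
        MvPolynomial.eval y h ≠ 0 → y = x) :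
    multAt
        (J ⊔ Ideal.span {MvPolynomial.X (none : Option (Fin n)) - MvPolynomial.C τ})
        (fun o => o.elim τ x)
      = multAt
        ((⨅ i ∈ S, Q i) ⊔
          Ideal.span {MvPolynomial.X (none : Option (Fin n)) - MvPolynomial.C τ})
        (fun o => o.elim τ x) := by
  classical
  set pt : Option (Fin n) → K := fun o => o.elim τ x with hpt
  set M : Ideal (MvPolynomial (Option (Fin n)) K) := vanishingIdeal K {pt}
  have hM : M.IsMaximal := inferInstance
  set t : MvPolynomial (Option (Fin n)) K := X none - C τ with ht
  have hJM : J ≤ M := by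
    rw [hJ, Ideal.span_le]
    rintro _ ⟨i, rfl⟩
    exact (mem_vanishingIdeal_singleton_iff pt _).2 (hroot i)
  have htM : t ∈ M := (mem_vanishingIdeal_singleton_iff pt _).2 (by simp [ht, hpt])
  have hMmin : M ∈ (J ⊔ Ideal.span {t}).minimalPrimes := by
    obtain ⟨h, hx, huniq⟩ := hiso
    have heval (y : Option (Fin n) → K) :
        eval y (rename some h) = eval (fun i ↦ y (some i)) h := eval_rename _ _ _
    refine vanishingIdeal_singleton_mem_minimalPrimes (h := rename some h)
      (sup_le hJM ((Ideal.span_singleton_le_iff_mem _).2 htM)) (by rw [heval]; exact hx) ?_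
    intro y hy hyh
    have hyτ : y none = τ := by
      have := hy t (Ideal.mem_sup_right (Ideal.mem_span_singleton_self t))
      simpa [ht, sub_eq_zero] using this
    have hyelim : y = fun o => o.elim τ (fun i ↦ y (some i)) := by
      funext o
      cases o
      · exact hyτ
      · rfl
    have hyx := huniq (fun i ↦ y (some i)) (fun i ↦ by
      rw [← hyelim]
      exact hy (b i) (Ideal.mem_sup_left (hJ ▸ Ideal.subset_span ⟨i, rfl⟩))) (by rwa [← heval])
    rw [hyelim, hyx]
  have hmin (P : Ideal (MvPolynomial (Option (Fin n)) K)) (hJP : J ≤ P) (hPM : P ≤ M) :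
      M ∈ (P ⊔ Ideal.span {t}).minimalPrimes :=
    ⟨⟨hM.isPrime, sup_le hPM ((Ideal.span_singleton_le_iff_mem _).2 htM)⟩,
      fun I hI hIM ↦ hMmin.2 ⟨hI.1, (sup_le_sup_right hJP _).trans hI.2⟩ hIM⟩
  have hne (P) (hP : P ∈ J.minimalPrimes) : P ≠ M := by
    rintro rfl
    have h1 := hB1 _ hM.isPrime hP
    let _ : Field (MvPolynomial (Option (Fin n)) K ⧸ M) := Ideal.Quotient.field M
    rw [ringKrullDim_eq_zero_of_field] at h1
    exact absurd h1 (by norm_num)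
  have hcurve (P) (hP : P ∈ J.minimalPrimes) (hPM : P ≤ M) :
      ringKrullDim (MvPolynomial (Option (Fin n)) K ⧸ P) ≤ 1 ∧ P.height = n :=
    have := hP.1.1
    ringKrullDim_quotient_le_one_and_height_eq (hne P hP) (hmin P hP.1.2 hPM)
  have hprimeHt (P) (hP : P ∈ J.minimalPrimes) (hPM : P ≤ M) : primeHt _ P = n := by
    have := hP.1.1
    rw [primeHt_eq_height, (hcurve P hP hPM).2]
    rfl
  have hass := hB2 M hM hJM ⟨fun P hP hPM ↦ (hprimeHt P hP hPM).ge, by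
    obtain ⟨P, hP, hPM⟩ := Ideal.exists_minimalPrimes_le hJM
    exact ⟨P, hP, hPM, hprimeHt P hP hPM⟩⟩
  have hmemS (i : Fin r) (hi : Q i ≤ M) : i ∈ S := by
    have hradM : (Q i).radical ≤ M := hM.isPrime.radical_le_iff.2 hi
    have hrad : (Q i).radical.IsPrime := Ideal.isPrime_radical (hQprimary i)
    have hJrad : J ≤ (Q i).radical := (hdec.trans_le (iInf_le Q i)).trans Ideal.le_radical
    have hheight : (Q i).radical.height = n := by
      have := hass _ (radical_mem_associatedPrimes Q hQprimary hdec hraddist hirred i) hradM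
      rw [primeHt_eq_height] at this
      exact_mod_cast this
    have hminimal : (Q i).radical ∈ J.minimalPrimes := by
      obtain ⟨P, hP, hPrad⟩ := Ideal.exists_minimalPrimes_le hJrad
      have := hP.1.1
      have heq : P = (Q i).radical := Ideal.eq_of_le_of_height_le P hPrad
        (by rw [hheight, (hcurve P hP (hPrad.trans hradM)).2])
      rwa [← heq]
    refine (hS i).2 ⟨hminimal, (hcurve _ hminimal hradM).1.antisymm (hB1 _ hrad hminimal), ?_⟩
    by_contra hdom
    have htrad : t ∈ (Q i).radical := X_sub_C_mem_of_not_dominant (pt := pt) hradM hdom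
    refine hne _ hminimal (hradM.antisymm ?_)
    exact (hmin _ hJrad hradM).2
      ⟨hrad, sup_le le_rfl ((Ideal.span_singleton_le_iff_mem _).2 htrad)⟩ hradM
  have hexists (i : Fin r) : ∃ q, q ∉ M ∧ (i ∉ S → q ∈ Q i) := by
    by_cases hi : i ∈ S
    · exact ⟨1, (Ideal.ne_top_iff_one M).1 hM.ne_top, fun h ↦ absurd hi h⟩
    · obtain ⟨q, hq, hqM⟩ := SetLike.not_le_iff_exists.1 fun h ↦ hi (hmemS i h)
      exact ⟨q, hqM, fun _ ↦ hq⟩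
  choose q hqM hqQ using hexists
  have hprod : eval pt (∏ i, q i) ≠ 0 := by
    rw [map_prod, Finset.prod_ne_zero_iff]
    exact fun i _ h ↦ hqM i ((mem_vanishingIdeal_singleton_iff pt _).2 h)
  unfold multAt
  rw [Ideal.map_sup, Ideal.map_sup, Ideal.map_eq_map_of_mul_mem _ (I := J) (I' := ⨅ i ∈ S, Q i) ?_
    (isUnit_translate_of_eval_ne_zero pt hprod) ?_]
  · rw [hdec]
    exact le_iInf₂ fun i _ ↦ iInf_le Q i
  · intro a ha
    rw [hdec, Ideal.mem_iInf]
    intro i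
    by_cases hi : i ∈ S
    · exact Ideal.mul_mem_left _ _ (iInf₂_le (f := fun i _ ↦ Q i) i hi ha)
    · exact Ideal.mul_mem_right _ _
        (Ideal.mem_of_dvd _ (Finset.dvd_prod_of_mem q (Finset.mem_univ i)) (hqQ i hi))
end
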